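/- Proposition 2 (margin bound on the posterior mass of the true changepoint): suppose γ > 0, κ* ∈ {1, ..., n−1}, a_i < −γ for all i ≤ κ*, and a_i > γ for all i > κ* (i.e., β lies in the margin set A_{κ*}^{γ}(X)). Then π(κ*) > (1 − e^{−γ})/(1 + e^{−γ}). -/

import Mathlib

open Real Finset

/-- The logistic (inverse logit) function `F(t) = eᵗ / (1 + eᵗ)`. -/
noncomputable def F (t : ℝ) : ℝ := Real.exp t / (1 + Real.exp t)

/-- The quasi-likelihood `Q(κ) = ∏_{i=1}^{κ} (1 − F(a_i)) · ∏_{i=κ+1}^{n} F(a_i)`. -/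
noncomputable def Q (n : ℕ) (a : ℕ → ℝ) (κ : ℕ) : ℝ :=
  (∏ i ∈ Finset.Icc 1 κ, (1 - F (a i))) * ∏ i ∈ Finset.Icc (κ + 1) n, F (a i)

/-- The posterior probability mass function `π(κ) = Q(κ) / ∑_{k=1}^{n−1} Q(k)`. -/
noncomputable def post (n : ℕ) (a : ℕ → ℝ) (κ : ℕ) : ℝ :=
  Q n a κ / ∑ k ∈ Finset.Icc 1 (n - 1), Q n a k

lemma one_sub_F (t : ℝ) : 1 - F t = Real.exp (-t) * F t := by
  have h := Real.exp_pos t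
  unfold F
  rw [Real.exp_neg]
  field_simp
  ring

lemma F_pos (t : ℝ) : 0 < F t := by
  unfold F
  positivity

lemma Q_pos (n : ℕ) (a : ℕ → ℝ) (κ : ℕ) : 0 < Q n a κ := by
  refine mul_pos (prod_pos fun i _ => ?_) (prod_pos fun i _ => F_pos _)
  rw [one_sub_F]
  exact mul_pos (Real.exp_pos _) (F_pos _)

/-- Moving the changepoint one step to the right multiplies `Q` by the inverse odds. -/
lemma Q_succ (n : ℕ) (a : ℕ → ℝ) {κ : ℕ} (h : κ + 1 ≤ n) :
    Q n a (κ + 1) = Real.exp (-a (κ + 1)) * Q n a κ := by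
  unfold Q
  rw [prod_Icc_succ_top (by omega), one_sub_F, ← mul_prod_Ioc_eq_prod_Icc h,
    ← Finset.Icc_add_one_left_eq_Ioc]
  ring

lemma sum_Ico_le_of_le_mul_succ {q : ℕ → ℝ} {r : ℝ} {s t : ℕ} (hst : s ≤ t)
    (h : ∀ k, s ≤ k → k < t → q k ≤ r * q (k + 1)) :
    (1 - r) * ∑ k ∈ Finset.Ico s t, q k ≤ r * (q t - q s) := by
  induction t, hst using Nat.le_induction with
  | base => simp
  | succ m hm ih =>
    rw [sum_Ico_succ_top hm]
    have h₁ := ih fun k hk hkm => h k hk (by omega)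
    have h₂ := h m hm (by omega)
    linarith

lemma sum_Ioc_le_of_succ_le_mul {q : ℕ → ℝ} {r : ℝ} {s t : ℕ} (hst : s ≤ t)
    (h : ∀ k, s ≤ k → k < t → q (k + 1) ≤ r * q k) :
    (1 - r) * ∑ k ∈ Finset.Ioc s t, q k ≤ r * (q s - q t) := by
  induction t, hst using Nat.le_induction with
  | base => simp
  | succ m hm ih =>
    rw [sum_Ioc_succ_top hm]
    have h₁ := ih fun k hk hkm => h k hk (by omega)
    have h₂ := h m hm (by omega)
    linarith

/-- Proposition 2 (margin bound on the posterior mass of the true changepoint): under the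
separation hypothesis (`β` lies in the margin set `A_{κ*}^{γ}(X)`),
`π(κ*) > (1 − e^{−γ})/(1 + e^{−γ})`. -/
theorem posterior_margin_bound (n : ℕ) (hn : 2 ≤ n) (a : ℕ → ℝ) (γ : ℝ) (hγ : 0 < γ)
    (κstar : ℕ) (hκs1 : 1 ≤ κstar) (hκs2 : κstar ≤ n - 1)
    (hpre : ∀ i, 1 ≤ i → i ≤ κstar → a i < -γ)
    (hpost : ∀ i, κstar < i → i ≤ n → γ < a i) :
    (1 - Real.exp (-γ)) / (1 + Real.exp (-γ)) < post n a κstar := by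
  have hr := Real.exp_pos (-γ)
  have left := sum_Ico_le_of_le_mul_succ (q := Q n a) (r := Real.exp (-γ)) hκs1
    fun k hk hkκ => by
      have ha := hpre (k + 1) (by omega) (by omega)
      rw [Q_succ n a (by omega), ← mul_assoc, ← Real.exp_add]
      exact le_mul_of_one_le_left (Q_pos n a k).le (Real.one_le_exp (by linarith))
  have right := sum_Ioc_le_of_succ_le_mul (q := Q n a) (r := Real.exp (-γ)) hκs2
    fun k hk hkn => by
      have ha := hpost (k + 1) (by omega) (by omega)
      rw [Q_succ n a (by omega)]
      exact mul_le_mul_of_nonneg_right (Real.exp_le_exp.2 (by linarith)) (Q_pos n a k).le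
  have split : ∑ k ∈ Finset.Icc 1 (n - 1), Q n a k =
      ∑ k ∈ Finset.Ico 1 κstar, Q n a k + Q n a κstar
        + ∑ k ∈ Finset.Ioc κstar (n - 1), Q n a k := by
    rw [← sum_Ico_succ_top hκs1, ← Finset.Ico_add_one_right_eq_Icc,
      ← Finset.Ico_add_one_add_one_eq_Ioc, sum_Ico_consecutive _ (by omega) (by omega)]
  have hsum : 0 < ∑ k ∈ Finset.Icc 1 (n - 1), Q n a k :=
    sum_pos (fun k _ => Q_pos n a k) ⟨1, Finset.mem_Icc.2 ⟨le_rfl, by omega⟩⟩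
  have h₁ := mul_pos hr (Q_pos n a 1)
  have h₂ := mul_pos hr (Q_pos n a (n - 1))
  unfold post
  rw [div_lt_div_iff₀ (by positivity) hsum, split]
  linarith
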